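/- Let U be a smooth function on ℝ^N ∖ {0} homogeneous of weight w ∈ ℝ, and let m ≥ 1 be an integer. Then Δ(Q^m · U) = Q^m · ΔU + 2m(n + 2w + 2m) · Q^{m−1} · U on ℝ^N ∖ {0}. (This power-of-Q commutator identity, obtained by iterating the paper's equation (delQ), underlies the harmonic extension argument.) -/

import Mathlib

open scoped BigOperators

/-- Partial derivative in the `A`-th coordinate direction. -/
noncomputable def pd {N : ℕ} (A : Fin N) (f : (Fin N → ℝ) → ℝ) : (Fin N → ℝ) → ℝ :=
  fun x => fderiv ℝ f x (Pi.single A 1)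

/-- Ambient Laplacian `Δf = ∑_{A,B} h^{AB} ∂_A ∂_B f` w.r.t. the inverse metric `hInv`. -/
noncomputable def lap {N : ℕ} (hInv : Matrix (Fin N) (Fin N) ℝ)
    (f : (Fin N → ℝ) → ℝ) : (Fin N → ℝ) → ℝ :=
  fun x => ∑ A : Fin N, ∑ B : Fin N, hInv A B * pd A (pd B f) x

/-- `X_A(x) = ∑_B h_{AB} x^B`. -/
def Xc {N : ℕ} (h : Matrix (Fin N) (Fin N) ℝ) (A : Fin N) : (Fin N → ℝ) → ℝ :=
  fun x => ∑ B : Fin N, h A B * x B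

/-- `Q(x) = ∑_{A,B} h_{AB} x^A x^B`. -/
def Qfun {N : ℕ} (h : Matrix (Fin N) (Fin N) ℝ) : (Fin N → ℝ) → ℝ :=
  fun x => ∑ A : Fin N, ∑ B : Fin N, h A B * x A * x B

/-- Smooth (C^∞) on `ℝ^N ∖ {0}`. -/
def SmoothOffZero {N : ℕ} (f : (Fin N → ℝ) → ℝ) : Prop :=
  ContDiffOn ℝ (⊤ : ℕ∞) f {x : Fin N → ℝ | x ≠ 0}

/-- Homogeneous of weight `w` on `ℝ^N ∖ {0}`. -/
def Homog {N : ℕ} (w : ℝ) (f : (Fin N → ℝ) → ℝ) : Prop :=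
  ∀ x : Fin N → ℝ, x ≠ 0 → (∑ A : Fin N, x A * pd A f x) = w * f x

/-- Ambient tractor-D operator at weight `w`: `(D^{(w)} f)_A = (n+2w−2)∂_A f − X_A Δf`. -/
noncomputable def Dop {N : ℕ} (n : ℕ) (h hInv : Matrix (Fin N) (Fin N) ℝ) (w : ℝ)
    (f : (Fin N → ℝ) → ℝ) (A : Fin N) : (Fin N → ℝ) → ℝ :=
  fun x => ((n : ℝ) + 2 * w - 2) * pd A f x - Xc h A x * lap hInv f x

/-- Iterated tractor-D: `seqD … w0 f A 0 = f` and
`seqD … w0 f A (j+1) = (D^{(w0−j)} (seqD … w0 f A j))_{A (j+1)}`. -/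
noncomputable def seqD {N : ℕ} (n : ℕ) (h hInv : Matrix (Fin N) (Fin N) ℝ)
    (w0 : ℝ) (f : (Fin N → ℝ) → ℝ) (A : ℕ → Fin N) : ℕ → (Fin N → ℝ) → ℝ
  | 0 => f
  | j + 1 => Dop n h hInv (w0 - (j : ℝ)) (seqD n h hInv w0 f A j) (A (j + 1))

/-- `u` is `O(Q^m)`: `u = Q^m · g` for some smooth `g` on `ℝ^N ∖ {0}`. -/
def BigOQ {N : ℕ} (h : Matrix (Fin N) (Fin N) ℝ) (m : ℕ) (u : (Fin N → ℝ) → ℝ) : Prop :=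
  ∃ g : (Fin N → ℝ) → ℝ, SmoothOffZero g ∧
    ∀ x : Fin N → ℝ, x ≠ 0 → u x = (Qfun h x) ^ m * g x

theorem pd_mul {N : ℕ} (A : Fin N) {f g : (Fin N → ℝ) → ℝ} {x : Fin N → ℝ}
    (hf : DifferentiableAt ℝ f x) (hg : DifferentiableAt ℝ g x) :
    pd A (fun y => f y * g y) x = f x * pd A g x + pd A f x * g x := by
  simp only [pd]
  rw [fderiv_fun_mul hf hg]
  simp [mul_comm]

theorem pd_add {N : ℕ} (A : Fin N) {f g : (Fin N → ℝ) → ℝ} {x : Fin N → ℝ}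
    (hf : DifferentiableAt ℝ f x) (hg : DifferentiableAt ℝ g x) :
    pd A (fun y => f y + g y) x = pd A f x + pd A g x := by
  simp only [pd]
  rw [fderiv_fun_add hf hg]
  simp

theorem contDiff_Xc {N : ℕ} (h : Matrix (Fin N) (Fin N) ℝ) (A : Fin N) :
    ContDiff ℝ (⊤ : ℕ∞) (Xc h A) := by
  unfold Xc
  fun_prop

theorem contDiff_Qfun {N : ℕ} (h : Matrix (Fin N) (Fin N) ℝ) :
    ContDiff ℝ (⊤ : ℕ∞) (Qfun h) := by
  unfold Qfun
  fun_prop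

theorem differentiable_Xc {N : ℕ} (h : Matrix (Fin N) (Fin N) ℝ) (A : Fin N) :
    Differentiable ℝ (Xc h A) :=
  (contDiff_Xc h A).differentiable (by simp)

theorem differentiable_Qfun {N : ℕ} (h : Matrix (Fin N) (Fin N) ℝ) :
    Differentiable ℝ (Qfun h) :=
  (contDiff_Qfun h).differentiable (by simp)

theorem pd_coord {N : ℕ} (A B : Fin N) (x : Fin N → ℝ) :
    pd A (fun y => y B) x = if B = A then 1 else 0 := by
  have hB : fderiv ℝ (fun y : Fin N → ℝ => y B) x = ContinuousLinearMap.proj B :=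
    (ContinuousLinearMap.proj (R := ℝ) (φ := fun _ : Fin N => ℝ) B).fderiv
  simp [pd, hB, Pi.single_apply]

theorem pd_sum {N : ℕ} (A : Fin N) {ι : Type*} (s : Finset ι) {f : ι → (Fin N → ℝ) → ℝ}
    {x : Fin N → ℝ} (hf : ∀ i ∈ s, DifferentiableAt ℝ (f i) x) :
    pd A (fun y => ∑ i ∈ s, f i y) x = ∑ i ∈ s, pd A (f i) x := by
  simp only [pd]
  rw [fderiv_fun_sum hf]
  simp

theorem pd_const {N : ℕ} (A : Fin N) (c : ℝ) (x : Fin N → ℝ) :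
    pd A (fun _ => c) x = 0 := by
  simp [pd]

theorem pd_Xc {N : ℕ} (h : Matrix (Fin N) (Fin N) ℝ) (A B : Fin N) (x : Fin N → ℝ) :
    pd A (Xc h B) x = h B A := by
  unfold Xc
  rw [pd_sum A _ (fun i _ => by fun_prop)]
  have key (C : Fin N) : pd A (fun y => h B C * y C) x = h B C * if C = A then 1 else 0 := by
    rw [pd_mul A (by fun_prop) (by fun_prop), pd_coord, pd_const]
    ring
  simp [key]

theorem Qfun_eq_sum_Xc {N : ℕ} (h : Matrix (Fin N) (Fin N) ℝ) (x : Fin N → ℝ) :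
    Qfun h x = ∑ A, x A * Xc h A x := by
  simp only [Qfun, Xc, Finset.mul_sum]
  exact Finset.sum_congr rfl fun A _ => Finset.sum_congr rfl fun B _ => by ring

theorem pd_Qfun {N : ℕ} {h : Matrix (Fin N) (Fin N) ℝ} (hSymm : ∀ A B, h A B = h B A)
    (A : Fin N) (x : Fin N → ℝ) : pd A (Qfun h) x = 2 * Xc h A x := by
  rw [funext (Qfun_eq_sum_Xc h)]
  have hd (C : Fin N) := differentiable_Xc h C
  rw [pd_sum A _ (fun i _ => by fun_prop)]
  have key (C : Fin N) : pd A (fun y => y C * Xc h C y) x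
      = h A C * x C + if C = A then Xc h C x else 0 := by
    rw [pd_mul A (by fun_prop) (hd C x), pd_coord, pd_Xc, hSymm C A]
    split_ifs <;> ring
  simp only [key, Finset.sum_add_distrib]
  simp [Xc]
  ring

theorem SmoothOffZero.contDiffAt {N : ℕ} {f : (Fin N → ℝ) → ℝ} (hf : SmoothOffZero f)
    {x : Fin N → ℝ} (hx : x ≠ 0) : ContDiffAt ℝ (⊤ : ℕ∞) f x :=
  ContDiffOn.contDiffAt hf (isOpen_ne.mem_nhds hx)

theorem SmoothOffZero.differentiableAt {N : ℕ} {f : (Fin N → ℝ) → ℝ} (hf : SmoothOffZero f)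
    {x : Fin N → ℝ} (hx : x ≠ 0) : DifferentiableAt ℝ f x :=
  (hf.contDiffAt hx).differentiableAt (by simp)

theorem SmoothOffZero.pd {N : ℕ} {f : (Fin N → ℝ) → ℝ} (hf : SmoothOffZero f) (A : Fin N) :
    SmoothOffZero (pd A f) := by
  intro x hx
  have h₁ : ContDiffAt ℝ (⊤ : ℕ∞) (fderiv ℝ f) x :=
    (hf.contDiffAt hx).fderiv_right (by simp)
  exact (h₁.clm_apply contDiffAt_const).contDiffWithinAt

theorem SmoothOffZero.Qfun_mul {N : ℕ} {f : (Fin N → ℝ) → ℝ} (hf : SmoothOffZero f)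
    (h : Matrix (Fin N) (Fin N) ℝ) : SmoothOffZero (fun y => Qfun h y * f y) :=
  (contDiff_Qfun h).contDiffOn.mul hf

theorem Homog.Qfun_mul {N : ℕ} {h : Matrix (Fin N) (Fin N) ℝ} (hSymm : ∀ A B, h A B = h B A)
    {w : ℝ} {f : (Fin N → ℝ) → ℝ} (hf : SmoothOffZero f) (hw : Homog w f) :
    Homog (w + 2) (fun y => Qfun h y * f y) := by
  intro x hx
  have key (A : Fin N) : x A * pd A (fun y => Qfun h y * f y) x
      = Qfun h x * (x A * pd A f x) + 2 * f x * (x A * Xc h A x) := by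
    rw [pd_mul A (differentiable_Qfun h x) (hf.differentiableAt hx), pd_Qfun hSymm]
    ring
  simp only [key, Finset.sum_add_distrib, ← Finset.mul_sum]
  rw [hw x hx, ← Qfun_eq_sum_Xc]
  ring

theorem pd_pd_Qfun_mul {N : ℕ} {h : Matrix (Fin N) (Fin N) ℝ} (hSymm : ∀ A B, h A B = h B A)
    {f : (Fin N → ℝ) → ℝ} (hf : SmoothOffZero f) (A B : Fin N) {x : Fin N → ℝ} (hx : x ≠ 0) :
    pd A (pd B (fun y => Qfun h y * f y)) x
      = Qfun h x * pd A (pd B f) x + 2 * (Xc h A x * pd B f x) + 2 * (Xc h B x * pd A f x)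
        + 2 * f x * h B A := by
  have hev : pd B (fun y => Qfun h y * f y) =ᶠ[nhds x]
      fun y => Qfun h y * pd B f y + (2 * Xc h B y) * f y := by
    filter_upwards [isOpen_ne.mem_nhds hx] with y hy
    rw [pd_mul B (differentiable_Qfun h y) (hf.differentiableAt hy), pd_Qfun hSymm]
  have hQ := differentiable_Qfun h x
  have hX := differentiable_Xc h B x
  have hfx := hf.differentiableAt hx
  have hpx := (hf.pd B).differentiableAt hx
  have hcongr : pd A (pd B (fun y => Qfun h y * f y)) x
      = pd A (fun y => Qfun h y * pd B f y + (2 * Xc h B y) * f y) x := by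
    rw [pd, hev.fderiv_eq, pd]
  rw [hcongr, pd_add A (hQ.fun_mul hpx) ((hX.const_mul 2).fun_mul hfx), pd_mul A hQ hpx,
    pd_mul A (hX.const_mul 2) hfx, pd_mul A (differentiableAt_const _) hX, pd_Qfun hSymm,
    pd_Xc, pd_const]
  ring

theorem sum_inv_mul_Xc {N : ℕ} {h hInv : Matrix (Fin N) (Fin N) ℝ} (hInvh : hInv * h = 1)
    (A : Fin N) (x : Fin N → ℝ) : ∑ B, hInv A B * Xc h B x = x A := by
  change (hInv.mulVec (h.mulVec x)) A = x A
  rw [Matrix.mulVec_mulVec, hInvh, Matrix.one_mulVec]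

theorem lap_Qfun_mul {N : ℕ} {h hInv : Matrix (Fin N) (Fin N) ℝ}
    (hSymm : ∀ A B, h A B = h B A) (hInvh : h * hInv = 1) {w : ℝ} {f : (Fin N → ℝ) → ℝ}
    (hf : SmoothOffZero f) (hw : Homog w f) {x : Fin N → ℝ} (hx : x ≠ 0) :
    lap hInv (fun y => Qfun h y * f y) x
      = Qfun h x * lap hInv f x + (2 * N + 4 * w) * f x := by
  have hLeft : hInv * h = 1 := mul_eq_one_comm.mp hInvh
  have hT : h.transpose = h := Matrix.ext fun A B => hSymm B A
  have hLeftT : hInv.transpose * h = 1 := by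
    simpa [Matrix.transpose_mul, hT] using congrArg Matrix.transpose hInvh
  have htrace : ∑ A, ∑ B, hInv A B * h B A = N := by
    change ∑ A, (hInv * h) A A = N
    simp [hLeft]
  have hfst : ∑ A, ∑ B, hInv A B * (Xc h A x * pd B f x) = w * f x := by
    rw [Finset.sum_comm, ← hw x hx]
    refine Finset.sum_congr rfl fun B _ => ?_
    rw [← sum_inv_mul_Xc hLeftT B x, Finset.sum_mul]
    exact Finset.sum_congr rfl fun A _ => (mul_assoc _ _ _).symm
  have hsnd : ∑ A, ∑ B, hInv A B * (Xc h B x * pd A f x) = w * f x := by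
    rw [← hw x hx]
    refine Finset.sum_congr rfl fun A _ => ?_
    rw [← sum_inv_mul_Xc hLeft A x, Finset.sum_mul]
    exact Finset.sum_congr rfl fun B _ => (mul_assoc _ _ _).symm
  have hterm (A B : Fin N) : hInv A B * pd A (pd B (fun y => Qfun h y * f y)) x
      = Qfun h x * (hInv A B * pd A (pd B f) x) + 2 * (hInv A B * (Xc h A x * pd B f x))
        + 2 * (hInv A B * (Xc h B x * pd A f x)) + 2 * f x * (hInv A B * h B A) := by
    rw [pd_pd_Qfun_mul hSymm hf A B hx]
    ring
  simp only [lap, hterm, Finset.sum_add_distrib, ← Finset.mul_sum _ _ (Qfun h x),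
    ← Finset.mul_sum _ _ (2 : ℝ), ← Finset.mul_sum _ _ (2 * f x), hfst, hsnd, htrace]
  ring

theorem smoothOffZero_Qfun_pow_mul {N : ℕ} (h : Matrix (Fin N) (Fin N) ℝ)
    {f : (Fin N → ℝ) → ℝ} (hf : SmoothOffZero f) (m : ℕ) :
    SmoothOffZero (fun y => Qfun h y ^ m * f y) :=
  ((contDiff_Qfun h).pow m).contDiffOn.mul hf

theorem homog_Qfun_pow_mul {N : ℕ} {h : Matrix (Fin N) (Fin N) ℝ}
    (hSymm : ∀ A B, h A B = h B A) {w : ℝ} {f : (Fin N → ℝ) → ℝ} (hf : SmoothOffZero f)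
    (hw : Homog w f) (m : ℕ) : Homog (w + 2 * m) (fun y => Qfun h y ^ m * f y) := by
  induction m with
  | zero => simpa using hw
  | succ k ih =>
    have := Homog.Qfun_mul hSymm (smoothOffZero_Qfun_pow_mul h hf k) ih
    convert this using 1
    · push_cast; ring
    · funext y; ring

/-- for `U` homogeneous of weight `w` and `m ≥ 1`,
`Δ(Q^m·U) = Q^m·ΔU + 2m(n+2w+2m)·Q^{m−1}·U` on `ℝ^N ∖ {0}`. -/
theorem laplacian_Qpow_commutator
    (n : ℕ) (hn : 1 ≤ n)
    (h hInv : Matrix (Fin (n + 2)) (Fin (n + 2)) ℝ)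
    (hSymm : ∀ A B, h A B = h B A) (hInvh : h * hInv = 1)
    (w : ℝ) (U : (Fin (n + 2) → ℝ) → ℝ) (hU : SmoothOffZero U) (hhom : Homog w U)
    (m : ℕ) (hm : 1 ≤ m) :
    ∀ x : Fin (n + 2) → ℝ, x ≠ 0 →
      lap hInv (fun y => (Qfun h y) ^ m * U y) x
        = (Qfun h x) ^ m * lap hInv U x
          + 2 * (m : ℝ) * ((n : ℝ) + 2 * w + 2 * (m : ℝ)) * (Qfun h x) ^ (m - 1) * U x := by
  clear hm
  intro x hx
  induction m with
  | zero => simp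
  | succ k ih =>
    have hstep : (fun y => Qfun h y ^ (k + 1) * U y)
        = fun y => Qfun h y * (Qfun h y ^ k * U y) := by
      funext y; ring
    rw [hstep, lap_Qfun_mul hSymm hInvh (smoothOffZero_Qfun_pow_mul h hU k)
      (homog_Qfun_pow_mul hSymm hU hhom k) hx, ih]
    cases k with
    | zero => push_cast [Nat.sub_self]; ring
    | succ j => push_cast [Nat.add_sub_cancel]; ring
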